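/- For every T > 0, every x ∈ ℝ^p and every δ > 0, there exist z ∈ ℝ^p and an admissible control pair (u, v) on [0,T] whose reversed controlled trajectory started at x satisfies Y(T) = z, such that v has at most p coordinate jumps in total (so γ I_L(v) ≤ pγα) and Ṽ(z) + (1/2)∫₀^T ‖u(t)‖² dt + γ I_L(v) ≤ V_{γ,T}(x) + δ. -/

import Mathlib

open MeasureTheory Set Filter Topology
open scoped ENNReal NNReal

noncomputable section

/-- `ℝ^p` with the Euclidean norm. -/
abbrev Ep (p : ℕ) : Type := EuclideanSpace ℝ (Fin p)

/-- The number of jump times `t i` that are `≤ s`. -/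
def jumpCount {k : ℕ} (t : Fin k → ℝ) (s : ℝ) : Fin (k + 1) :=
  ⟨(Finset.univ.filter fun i => t i ≤ s).card,
    Nat.lt_succ_of_le (le_trans (Finset.card_filter_le _ _) (by simp))⟩

/-- `v` is a right-continuous piecewise constant path on `S` with `k` jumps, whose
jump times `t 0 < t 1 < ⋯ < t (k-1)` lie in `J`, whose successive values are
`a 0, a 1, …, a k`, and at each jump exactly one coordinate of `v` changes. -/
def IsPCData {p k : ℕ} (t : Fin k → ℝ) (a : Fin (k + 1) → Ep p)
    (v : ℝ → Ep p) (S J : Set ℝ) : Prop :=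
  StrictMono t ∧ (∀ i, t i ∈ J) ∧ (∀ s ∈ S, v s = a (jumpCount t s)) ∧
    ∀ i : Fin k, ∃! j : Fin p, a (Fin.castSucc i) j ≠ a (Fin.succ i) j

/-- `v` is right-continuous, piecewise constant on `[0,T]` with `k` jumps (in `(0,T]`),
each jump being in exactly one coordinate. -/
def IsPCPath (p : ℕ) (T : ℝ) (v : ℝ → Ep p) (k : ℕ) : Prop :=
  ∃ (t : Fin k → ℝ) (a : Fin (k + 1) → Ep p), IsPCData t a v (Icc 0 T) (Ioc 0 T)

/-- `v` is right-continuous, piecewise constant on `[0,∞)` with `k` jumps,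
each jump being in exactly one coordinate. -/
def IsPCPathInf (p : ℕ) (v : ℝ → Ep p) (k : ℕ) : Prop :=
  ∃ (t : Fin k → ℝ) (a : Fin (k + 1) → Ep p), IsPCData t a v (Ici 0) (Ioi 0)

/-- `u` is Borel measurable with `∫₀ᵀ ‖u‖² < ∞`. -/
def AdmissibleU (p : ℕ) (T : ℝ) (u : ℝ → Ep p) : Prop :=
  Measurable u ∧ IntegrableOn (fun s => ‖u s‖ ^ 2) (Icc 0 T)

/-- `u` is Borel measurable with `∫₀^∞ ‖u‖² < ∞`. -/
def AdmissibleUInf (p : ℕ) (u : ℝ → Ep p) : Prop :=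
  Measurable u ∧ IntegrableOn (fun s => ‖u s‖ ^ 2) (Ici 0)

/-- The reversed controlled trajectory started at `x`: `Y(0) = x`,
`Y' = -b(Y) + u` between the jump times of `v`, and at each jump time of `v`
the path `Y` jumps by the same amount as `v`; equivalently,
`Y(s) = x + ∫₀ˢ (-b(Y(r)) + u(r)) dr + (v(s) - v(0))` on `S`. -/
def RevTraj (p : ℕ) (b : Ep p → Ep p) (u v Y : ℝ → Ep p) (x : Ep p) (S : Set ℝ) : Prop :=
  ∀ s ∈ S, Y s = x + (∫ r in (0:ℝ)..s, (-b (Y r) + u r)) + (v s - v 0)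

/-- The value `V_{γ,T}(x)`: infimum over `z` and admissible control pairs `(u,v)` on `[0,T]`
whose reversed controlled trajectory `Y` started at `x` ends at `Y(T) = z`, of
`Ṽ(z) + (1/2)∫₀ᵀ ‖u‖² + γ·I_L(v)`, where `I_L(v) = α · (number of coordinate jumps of v)`. -/
def VT (p : ℕ) (b : Ep p → Ep p) (Vt : Ep p → ℝ≥0∞) (γ α T : ℝ) (x : Ep p) : ℝ≥0∞ :=
  ⨅ (z : Ep p) (k : ℕ) (u : ℝ → Ep p) (v : ℝ → Ep p) (_ : AdmissibleU p T u)
    (_ : IsPCPath p T v k)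
    (_ : ∃ Y : ℝ → Ep p, RevTraj p b u v Y x (Icc 0 T) ∧ Y T = z),
    Vt z + ENNReal.ofReal ((1 / 2) * (∫ s in Icc (0:ℝ) T, ‖u s‖ ^ 2) + γ * (α * k))

/-- The value `V_γ(x)`: infimum over admissible control pairs `(u,v)` on `[0,∞)`
whose reversed controlled trajectory `Y` started at `x` satisfies `Y(t) → 0`, of
`(1/2)∫₀^∞ ‖u‖² + γ·I_L(v)`. -/
def Vinf (p : ℕ) (b : Ep p → Ep p) (γ α : ℝ) (x : Ep p) : ℝ≥0∞ :=
  ⨅ (k : ℕ) (u : ℝ → Ep p) (v : ℝ → Ep p) (_ : AdmissibleUInf p u)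
    (_ : IsPCPathInf p v k)
    (_ : ∃ Y : ℝ → Ep p, RevTraj p b u v Y x (Ici 0) ∧ Tendsto Y atTop (𝓝 0)),
    ENNReal.ofReal ((1 / 2) * (∫ s in Ici (0:ℝ), ‖u s‖ ^ 2) + γ * (α * k))

/-- `φ` is a solution of the forward ODE `φ' = b(φ)` on `[0,∞)`. -/
def ForwardSol (p : ℕ) (b : Ep p → Ep p) (φ : ℝ → Ep p) : Prop :=
  ∀ t ∈ Ici (0:ℝ), φ t = φ 0 + ∫ r in (0:ℝ)..t, b (φ r)


/-- The number of elapsed jumps is a measurable function of time. -/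
theorem measurable_jumpCount {k : ℕ} (t : Fin k → ℝ) : Measurable (jumpCount t) := by
  have h : Measurable fun s => (jumpCount t s : ℕ) := by
    have : (fun s => (jumpCount t s : ℕ)) = fun s => ∑ i, if t i ≤ s then 1 else 0 := by
      funext s
      simp only [jumpCount]
      rw [Finset.card_filter]
    rw [this]
    exact Finset.measurable_sum _ fun i _ =>
      Measurable.ite measurableSet_Ici measurable_const measurable_const
  refine measurable_to_countable' fun i => ?_
  have : jumpCount t ⁻¹' {i} = (fun s => (jumpCount t s : ℕ)) ⁻¹' {(i : ℕ)} := by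
    ext s
    simp [Fin.ext_iff]
  rw [this]
  exact h (measurableSet_singleton _)

theorem jumpCount_eq_zero {k : ℕ} {t : Fin k → ℝ} {s : ℝ} (h : ∀ i, s < t i) :
    jumpCount t s = 0 := by
  ext
  simp [jumpCount, Finset.filter_eq_empty_iff, h]

theorem jumpCount_eq_last {k : ℕ} {t : Fin k → ℝ} {s : ℝ} (h : ∀ i, t i ≤ s) :
    jumpCount t s = Fin.last k := by
  ext
  simp [jumpCount, h]

/-- Every vector can be steered to the origin by changing one nonzero coordinate at a time. -/
theorem exists_coordinate_jumps {p : ℕ} (x : Ep p) :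
    ∃ k ≤ p, ∃ a : Fin (k + 1) → Ep p, a 0 = 0 ∧ a (Fin.last k) = -x ∧
      ∀ i : Fin k, ∃! j : Fin p, a (Fin.castSucc i) j ≠ a (Fin.succ i) j := by
  classical
  obtain ⟨m, hm, ⟨e⟩⟩ : ∃ m ≤ p, Nonempty (Fin m ≃ {j : Fin p // x j ≠ 0}) :=
    ⟨_, (Fintype.card_subtype_le _).trans_eq (Fintype.card_fin p),
      ⟨(Fintype.equivFin _).symm⟩⟩
  refine ⟨m, hm,
    fun i => WithLp.toLp 2 fun j =>
      if ∃ l : Fin m, (l : ℕ) < i ∧ (e l : Fin p) = j then -x j else 0,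
    ?_, ?_, fun i => ⟨e i, ?_, ?_⟩⟩
  · ext j
    simp
  · ext j
    by_cases hj : x j = 0
    · simp [hj]
    · have : ∃ l, (e l : Fin p) = j := ⟨e.symm ⟨j, hj⟩, by simp⟩
      simp [this]
  · have h₁ : ¬ ∃ l : Fin m, (l : ℕ) < i ∧ (e l : Fin p) = e i := by
      rintro ⟨l, hl, h⟩
      rw [e.injective (Subtype.ext h)] at hl
      exact lt_irrefl _ hl
    have h₂ : ∃ l : Fin m, (l : ℕ) < i + 1 ∧ (e l : Fin p) = e i := ⟨i, Nat.lt_succ_self _, rfl⟩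
    simpa only [Fin.val_castSucc, Fin.val_succ, if_neg h₁, if_pos h₂] using
      (neg_ne_zero.2 (e i).2).symm
  · intro j hj
    by_contra hne
    refine hj ?_
    have : (∃ l : Fin m, (l : ℕ) < i + 1 ∧ (e l : Fin p) = j) ↔
        ∃ l : Fin m, (l : ℕ) < i ∧ (e l : Fin p) = j := by
      refine ⟨?_, fun ⟨l, hl, h⟩ => ⟨l, hl.trans (Nat.lt_succ_self _), h⟩⟩
      rintro ⟨l, hl, h⟩
      refine ⟨l, lt_of_le_of_ne (Nat.lt_succ_iff.1 hl) fun hli => hne ?_, h⟩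
      rw [← h, Fin.ext hli]
    simp only [Fin.val_castSucc, Fin.val_succ, this]

/-- Any starting point can be brought to the origin by at most `p` coordinate jumps and a
control of arbitrarily small energy, which holds the state still between the jumps. -/
theorem exists_control_to_zero {p : ℕ} {b : Ep p → Ep p} (hb : Continuous b) (hb0 : b 0 = 0)
    {T : ℝ} (hT : 0 < T) (x : Ep p) {δ : ℝ} (hδ : 0 < δ) :
    ∃ (k : ℕ) (u v Y : ℝ → Ep p), AdmissibleU p T u ∧ IsPCPath p T v k ∧ k ≤ p ∧
      RevTraj p b u v Y x (Icc 0 T) ∧ Y T = 0 ∧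
      (1 / 2) * (∫ s in Icc (0:ℝ) T, ‖u s‖ ^ 2) ≤ δ := by
  obtain ⟨k, hk, a, ha0, hal, ha⟩ := exists_coordinate_jumps x
  obtain ⟨M, hM⟩ : ∃ M, ∀ i, ‖b (x + a i)‖ ^ 2 ≤ M := by
    obtain ⟨M, hM⟩ := (Set.finite_range fun i => ‖b (x + a i)‖ ^ 2).bddAbove
    exact ⟨M, fun i => hM ⟨i, rfl⟩⟩
  have hM0 : 0 ≤ M := (sq_nonneg _).trans (hM 0)
  obtain ⟨ε, hε, hεT, hεM⟩ : ∃ ε > 0, ε ≤ T ∧ ε * M ≤ δ := by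
    refine ⟨min T (δ / (M + 1)), lt_min hT (by positivity), min_le_left _ _, ?_⟩
    calc min T (δ / (M + 1)) * M ≤ δ / (M + 1) * (M + 1) := by
          gcongr
          · exact min_le_right _ _
          · linarith
      _ = δ := div_mul_cancel₀ _ (by positivity)
  let t : Fin k → ℝ := fun i => ε * ((i + 1) / (k + 1))
  have ht0 : ∀ i, 0 < t i := fun i => by positivity
  have htε : ∀ i, t i ≤ ε := fun i => by
    refine mul_le_of_le_one_right hε.le ((div_le_one (by positivity)).2 ?_)
    have : (i : ℝ) ≤ k := by exact_mod_cast i.2.le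
    linarith
  have htm : StrictMono t := fun i j hij => by
    have : (i : ℝ) < j := by exact_mod_cast hij
    dsimp only [t]
    gcongr
  let v : ℝ → Ep p := fun s => a (jumpCount t s)
  have hv0 : v 0 = 0 := by simp only [v, jumpCount_eq_zero ht0, ha0]
  have hvl : ∀ s, ε ≤ s → v s = -x := fun s hs => by
    simp only [v, jumpCount_eq_last fun i => (htε i).trans hs, hal]
  have hvm : Measurable v := (measurable_of_finite a).comp (measurable_jumpCount t)
  let u : ℝ → Ep p := fun s => b (x + v s)
  have hum : Measurable u := hb.measurable.comp (hvm.const_add x)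
  have huM : ∀ s, ‖u s‖ ^ 2 ≤ M := fun s => hM _
  have hui : IntegrableOn (fun s => ‖u s‖ ^ 2) (Icc 0 T) :=
    Measure.integrableOn_of_bounded (M := M) (by simp) (hum.norm.pow_const 2).aestronglyMeasurable
      (ae_of_all _ fun s => by simpa using huM s)
  refine ⟨k, u, v, fun s => x + v s, ⟨hum, hui⟩,
    ⟨t, a, htm, fun i => ⟨ht0 i, (htε i).trans hεT⟩, fun _ _ => rfl, ha⟩, hk, ?_, ?_, ?_⟩
  · intro s _
    simp [u, hv0]
  · simp [hvl T hεT]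
  · have hsub : ∫ s in Icc (0:ℝ) T, ‖u s‖ ^ 2 = ∫ s in Icc (0:ℝ) ε, ‖u s‖ ^ 2 := by
      refine (setIntegral_eq_of_subset_of_forall_sdiff_eq_zero measurableSet_Icc
        (Icc_subset_Icc_right hεT) fun s hs => ?_)
      have : ε ≤ s := by
        by_contra! h
        exact hs.2 ⟨hs.1.1, h.le⟩
      simp [u, hvl s this, hb0]
    have hle : ∫ s in Icc (0:ℝ) ε, ‖u s‖ ^ 2 ≤ ∫ _ in Icc (0:ℝ) ε, M :=
      setIntegral_mono (hui.mono_set (Icc_subset_Icc_right hεT)) (by simp) huM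
    have hc : ∫ _ in Icc (0:ℝ) ε, M = ε * M := by simp [hε.le]
    rw [hsub]
    have : 0 ≤ ∫ s in Icc (0:ℝ) ε, ‖u s‖ ^ 2 := integral_nonneg fun s => by positivity
    linarith

/-- for every `T > 0`, `x` and `δ > 0` there is a `δ`-optimal choice of
`z` and admissible control pair `(u,v)` for `V_{γ,T}(x)` whose impulse part `v` has at
most `p` coordinate jumps (so `γ·I_L(v) ≤ p·γ·α`). -/
theorem nearly_optimal_few_impulses
    (p : ℕ) (hp : 1 ≤ p) (b : Ep p → Ep p) (L : ℝ≥0)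
    (hb : LipschitzWith L b) (hb0 : b 0 = 0)
    (hattract : ∀ φ : ℝ → Ep p, ForwardSol p b φ → Tendsto φ atTop (𝓝 0))
    (hstable : ∀ ε > (0:ℝ), ∃ δ > (0:ℝ), ∀ φ : ℝ → Ep p, ForwardSol p b φ →
      ‖φ 0‖ ≤ δ → ∀ t ≥ (0:ℝ), ‖φ t‖ ≤ ε)
    (α γ : ℝ) (hα1 : 1 < α) (hα2 : α < 2) (hγ : 0 < γ)
    (Vt : Ep p → ℝ≥0∞) (hlsc : LowerSemicontinuous Vt)
    (hcpt : ∀ c : ℝ≥0∞, c ≠ ⊤ → IsCompact {y : Ep p | Vt y ≤ c})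
    (hconv : ∀ y z : Ep p, y ≠ z → Vt y ≠ ⊤ → Vt z ≠ ⊤ →
      ∀ s t : ℝ, 0 < s → 0 < t → s + t = 1 →
        Vt (s • y + t • z) < ENNReal.ofReal s * Vt y + ENNReal.ofReal t * Vt z)
    (hV0 : Vt 0 = 0) (hVpos : ∀ y : Ep p, y ≠ 0 → 0 < Vt y)
    : ∀ T > (0:ℝ), ∀ x : Ep p, ∀ δ > (0:ℝ),
      ∃ (z : Ep p) (k : ℕ) (u v Y : ℝ → Ep p),
        AdmissibleU p T u ∧ IsPCPath p T v k ∧ k ≤ p ∧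
        RevTraj p b u v Y x (Icc 0 T) ∧ Y T = z ∧
        Vt z + ENNReal.ofReal ((1 / 2) * (∫ s in Icc (0:ℝ) T, ‖u s‖ ^ 2) + γ * (α * k))
          ≤ VT p b Vt γ α T x + ENNReal.ofReal δ := by
  intro T hT x δ hδ
  have hγα : 0 < γ * α := by positivity
  obtain ⟨k, u, v, Y, hu, hv, hkp, hY, hYT, hcost⟩ :=
    exists_control_to_zero hb.continuous hb0 hT x hδ
  rcases le_or_gt (ENNReal.ofReal (γ * (α * p))) (VT p b Vt γ α T x) with hle | hlt
  · refine ⟨0, k, u, v, Y, hu, hv, hkp, hY, hYT, ?_⟩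
    rw [hV0, zero_add]
    refine le_trans ?_ (add_le_add_left hle _)
    rw [← ENNReal.ofReal_add (by positivity) hδ.le]
    refine ENNReal.ofReal_le_ofReal ?_
    have : γ * (α * k) ≤ γ * (α * p) := by gcongr
    linarith
  · have hlt' : VT p b Vt γ α T x < min (ENNReal.ofReal (γ * (α * p)))
        (VT p b Vt γ α T x + ENNReal.ofReal δ) :=
      lt_min hlt (ENNReal.lt_add_right hlt.ne_top (by simpa using hδ))
    generalize hc : min (ENNReal.ofReal (γ * (α * p)))
      (VT p b Vt γ α T x + ENNReal.ofReal δ) = c at hlt'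
    rw [VT] at hlt'
    simp only [iInf_lt_iff] at hlt'
    obtain ⟨z, k, u, v, hu, hv, ⟨Y, hY, hYT⟩, h⟩ := hlt'
    rw [← hc, lt_min_iff] at h
    refine ⟨z, k, u, v, Y, hu, hv, ?_, hY, hYT, h.2.le⟩
    have h₁ := (ENNReal.ofReal_lt_ofReal_iff_of_nonneg (by positivity)).1
      (le_add_self.trans_lt h.1)
    have h₂ : 0 ≤ ∫ s in Icc (0:ℝ) T, ‖u s‖ ^ 2 := integral_nonneg fun s => by positivity
    have h₃ : γ * α * k < γ * α * p := by linarith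
    exact_mod_cast (lt_of_mul_lt_mul_left h₃ hγα.le).le
end
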